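/- The maximal two-sided ideals of R are exactly the ideals ⟨1 − xy, f(x)⟩, where f ranges over the monic irreducible polynomials in k[X] that are not monomials (i.e., f ≠ X^n for every n ≥ 0), and f(x) denotes the image of f under the k-algebra map k[X] → R sending X to x. -/

import Mathlib

/-!
`R = k⟨x,y⟩/⟨yx − 1⟩` is the associative `k`-algebra generated by `x` and `y`
with the single defining relation `y * x = 1` (the one-sided inverse of `k[x]`).
We realize it as the `RingQuot` of the free algebra on two generators.
-/

noncomputable section

/-- The defining relation `y * x = 1` on the free algebra `k⟨x,y⟩`. -/
inductive PreRel (k : Type) [Field k] : FreeAlgebra k (Fin 2) → FreeAlgebra k (Fin 2) → Prop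
  | yx : PreRel k (FreeAlgebra.ι k 1 * FreeAlgebra.ι k 0) 1

/-- `R = k⟨x,y⟩/⟨yx − 1⟩`. -/
abbrev R (k : Type) [Field k] := RingQuot (PreRel k)

/-- The generator `x` of `R`. -/
def Xg (k : Type) [Field k] : R k := RingQuot.mkAlgHom k (PreRel k) (FreeAlgebra.ι k 0)

/-- The generator `y` of `R`. -/
def Yg (k : Type) [Field k] : R k := RingQuot.mkAlgHom k (PreRel k) (FreeAlgebra.ι k 1)

theorem aux_neg {A : Type} [Ring A] (a b : A) (h : a * b = 0) : a * -b = 0 := by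
  rw [mul_neg, h, neg_zero]

theorem aux_ring {A : Type} [Ring A] (u v q p r s : A) (h : u * q = q * u) :
    u * v * (r * s) - q * p = u * (v * r - q) * s + q * (u * s - p) := by
  rw [mul_sub, h]
  noncomm_ring

theorem R_ind (k : Type) [Field k] {P : R k → Prop}
    (hc : ∀ c : k, P (algebraMap k (R k) c)) (hx : P (Xg k)) (hy : P (Yg k))
    (hm : ∀ a b, P a → P b → P (a * b)) (ha : ∀ a b, P a → P b → P (a + b)) (r : R k) : P r := by
  obtain ⟨a, rfl⟩ := RingQuot.mkAlgHom_surjective k (PreRel k) r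
  induction a using FreeAlgebra.induction with
  | grade0 c => simpa using hc c
  | grade1 i =>
    fin_cases i
    · exact hx
    · exact hy
  | mul a b h1 h2 => rw [map_mul]; exact hm _ _ h1 h2
  | add a b h1 h2 => rw [map_add]; exact ha _ _ h1 h2

theorem YX (k : Type) [Field k] : Yg k * Xg k = 1 := by
  have h := RingQuot.mkAlgHom_rel k (PreRel.yx (k := k))
  rw [map_mul, map_one] at h
  exact h

theorem YXpow (k : Type) [Field k] (n : ℕ) : Yg k ^ n * Xg k ^ n = 1 := by
  induction n with
  | zero => simp
  | succ n ih =>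
    rw [pow_succ, pow_succ']
    calc _ = Yg k ^ n * (Yg k * Xg k) * Xg k ^ n := by noncomm_ring
      _ = 1 := by rw [YX, mul_one, ih]

theorem kill_left (k : Type) [Field k] (a : R k) :
    ∀ r : R k, (∃ n : ℕ, Yg k ^ n * r = 0) → ∃ n : ℕ, Yg k ^ n * (a * r) = 0 := by
  induction a using R_ind with
  | hc c =>
    rintro r ⟨n, h⟩
    exact ⟨n, by rw [← mul_assoc, ← Algebra.commutes, mul_assoc, h, mul_zero]⟩
  | hx =>
    rintro r ⟨n, h⟩
    exact ⟨n + 1, by rw [pow_succ, mul_assoc, ← mul_assoc (Yg k), YX, one_mul, h]⟩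
  | hy =>
    rintro r ⟨n, h⟩
    exact ⟨n, by rw [← mul_assoc, ← pow_succ, pow_succ', mul_assoc, h, mul_zero]⟩
  | hm a b h1 h2 =>
    intro r hr
    simpa [mul_assoc] using h1 _ (h2 _ hr)
  | ha a b h1 h2 =>
    intro r hr
    obtain ⟨n, hn⟩ := h1 r hr
    obtain ⟨m, hm⟩ := h2 r hr
    refine ⟨n + m, ?_⟩
    rw [add_mul, mul_add]
    nth_rewrite 1 [add_comm n m]
    rw [pow_add, pow_add, mul_assoc, mul_assoc, hn, hm]
    simp

theorem span_e_kill (k : Type) [Field k] {r : R k}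
    (hr : r ∈ TwoSidedIdeal.span {1 - Xg k * Yg k}) : ∃ n : ℕ, Yg k ^ n * r = 0 := by
  induction hr using TwoSidedIdeal.span_induction with
  | mem x h =>
    rw [Set.mem_singleton_iff] at h
    subst h
    exact ⟨1, by rw [pow_one, mul_sub, ← mul_assoc, YX]; simp⟩
  | zero => exact ⟨0, by simp⟩
  | add a b _ _ h1 h2 =>
    obtain ⟨n, hn⟩ := h1
    obtain ⟨m, hm⟩ := h2
    refine ⟨n + m, ?_⟩
    rw [mul_add]
    nth_rewrite 1 [add_comm n m]
    rw [pow_add, pow_add, mul_assoc, mul_assoc, hn, hm]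
    simp
  | neg a _ h1 =>
    obtain ⟨n, hn⟩ := h1
    exact ⟨n, aux_neg _ _ hn⟩
  | left_absorb a b _ h => exact kill_left k a b h
  | right_absorb a b _ h =>
    obtain ⟨n, hn⟩ := h
    exact ⟨n, by rw [← mul_assoc, hn, zero_mul]⟩

theorem coatom_mem_e (k : Type) [Field k] (I : TwoSidedIdeal (R k)) (hI : IsCoatom I) :
    1 - Xg k * Yg k ∈ I := by
  by_contra hne
  have hlt : I < I ⊔ TwoSidedIdeal.span {1 - Xg k * Yg k} := by
    refine lt_of_le_of_ne le_sup_left fun h => hne ?_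
    rw [h]
    exact TwoSidedIdeal.mem_sup_right (TwoSidedIdeal.subset_span rfl)
  have htop := hI.2 _ hlt
  have h1 : (1 : R k) ∈ I ⊔ TwoSidedIdeal.span {1 - Xg k * Yg k} := by
    rw [htop]; exact TwoSidedIdeal.mem_top _
  obtain ⟨i, hi, f, hf, hif⟩ := TwoSidedIdeal.mem_sup.1 h1
  obtain ⟨n, hn⟩ := span_e_kill k hf
  apply hI.1
  rw [← TwoSidedIdeal.one_mem_iff, ← YXpow k n]
  apply TwoSidedIdeal.mul_mem_right
  have : Yg k ^ n = Yg k ^ n * i := by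
    rw [← add_zero (Yg k ^ n * i), ← hn, ← mul_add, hif, mul_one]
  rw [this]
  exact TwoSidedIdeal.mul_mem_left _ _ _ hi

open Polynomial

theorem clear_denom (k : Type) [Field k] (I : TwoSidedIdeal (R k)) (he : 1 - Xg k * Yg k ∈ I)
    (r : R k) : ∃ (n : ℕ) (q : k[X]), Xg k ^ n * r - aeval (Xg k) q ∈ I := by
  have hcomm : ∀ (n : ℕ) (q : k[X]), Xg k ^ n * aeval (Xg k) q = aeval (Xg k) (X ^ n * q) := by
    intro n q; simp
  induction r using R_ind with
  | hc c => exact ⟨0, C c, by simpa using I.zero_mem⟩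
  | hx => exact ⟨0, X, by simpa using I.zero_mem⟩
  | hy => exact ⟨1, 1, by simpa using I.neg_mem he⟩
  | hm r s h1 h2 =>
    obtain ⟨n, q, h1⟩ := h1
    obtain ⟨m, p, h2⟩ := h2
    refine ⟨m + n, q * p, ?_⟩
    have e : Xg k ^ (m + n) * (r * s) - aeval (Xg k) (q * p) =
        Xg k ^ m * (Xg k ^ n * r - aeval (Xg k) q) * s
          + aeval (Xg k) q * (Xg k ^ m * s - aeval (Xg k) p) := by
      have e2 : Xg k ^ m * aeval (Xg k) q = aeval (Xg k) q * Xg k ^ m := by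
        rw [hcomm, mul_comm, map_mul]; simp
      rw [map_mul, pow_add]
      exact aux_ring _ _ _ _ _ _ e2
    rw [e]
    exact I.add_mem (I.mul_mem_right _ _ (I.mul_mem_left _ _ h1)) (I.mul_mem_left _ _ h2)
  | ha r s h1 h2 =>
    obtain ⟨n, q, h1⟩ := h1
    obtain ⟨m, p, h2⟩ := h2
    refine ⟨m + n, X ^ m * q + X ^ n * p, ?_⟩
    have e : Xg k ^ (m + n) * (r + s) - aeval (Xg k) (X ^ m * q + X ^ n * p) =
        Xg k ^ m * (Xg k ^ n * r - aeval (Xg k) q)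
          + Xg k ^ n * (Xg k ^ m * s - aeval (Xg k) p) := by
      rw [map_add, ← hcomm, ← hcomm, mul_sub, mul_sub, mul_add]
      nth_rewrite 2 [add_comm m n]
      rw [pow_add, pow_add, mul_assoc, mul_assoc]
      abel
    rw [e]
    exact I.add_mem (I.mul_mem_left _ _ h1) (I.mul_mem_left _ _ h2)

theorem mem_of_pow (k : Type) [Field k] (I : TwoSidedIdeal (R k)) (n : ℕ) (r : R k)
    (h : Xg k ^ n * r ∈ I) : r ∈ I := by
  have := I.mul_mem_left (Yg k ^ n) _ h
  rwa [← mul_assoc, YXpow, one_mul] at this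

/-- The ideal `⟨1 - xy, g(x)⟩`. -/
abbrev Mg (k : Type) [Field k] (g : k[X]) : TwoSidedIdeal (R k) :=
  TwoSidedIdeal.span {1 - Xg k * Yg k, aeval (Xg k) g}

theorem e_mem_Mg (k : Type) [Field k] (g : k[X]) : 1 - Xg k * Yg k ∈ Mg k g :=
  TwoSidedIdeal.subset_span (by simp)

/-- Membership criterion: clear denominators and test divisibility by `g`. -/
theorem mem_Mg_of (k : Type) [Field k] (g : k[X]) (n : ℕ) (q : k[X]) (r : R k)
    (h : Xg k ^ n * r - aeval (Xg k) q ∈ Mg k g) (hq : g ∣ q) : r ∈ Mg k g := by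
  apply mem_of_pow k _ n
  have hg : aeval (Xg k) g ∈ Mg k g := TwoSidedIdeal.subset_span (by simp)
  obtain ⟨c, rfl⟩ := hq
  have := (Mg k g).add_mem h ((Mg k g).mul_mem_right _ (aeval (Xg k) c) hg)
  rwa [map_mul, sub_add_cancel] at this

theorem exists_hom (k : Type) [Field k] (L : Type) [Field L] [Algebra k L] (a : L) (ha : a ≠ 0) :
    ∃ ψ : R k →ₐ[k] L, ψ (Xg k) = a ∧ ψ (Yg k) = a⁻¹ := by
  let F : FreeAlgebra k (Fin 2) →ₐ[k] L := FreeAlgebra.lift k ![a, a⁻¹]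
  have hF : ∀ ⦃u v⦄, PreRel k u v → F u = F v := by
    rintro _ _ ⟨⟩
    simp [F, ha]
  refine ⟨RingQuot.liftAlgHom k ⟨F, hF⟩, ?_, ?_⟩
  · rw [Xg, RingQuot.liftAlgHom_mkAlgHom_apply]; simp [F]
  · rw [Yg, RingQuot.liftAlgHom_mkAlgHom_apply]; simp [F]

theorem Mg_coatom (k : Type) [Field k] (g : k[X]) (hm : g.Monic) (hi : Irreducible g)
    (hX : ∀ n : ℕ, g ≠ X ^ n) : IsCoatom (Mg k g) := by
  have : Fact (Irreducible g) := ⟨hi⟩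
  have ha : AdjoinRoot.root g ≠ 0 := by
    intro h
    rw [← AdjoinRoot.mk_X, AdjoinRoot.mk_eq_zero] at h
    have := (hi.associated_of_dvd irreducible_X h)
    exact hX 1 (by rw [pow_one]; exact eq_of_monic_of_associated hm monic_X this)
  obtain ⟨ψ, hψx, hψy⟩ := exists_hom k (AdjoinRoot g) (AdjoinRoot.root g) ha
  have hψ : ∀ q : k[X], ψ (aeval (Xg k) q) = AdjoinRoot.mk g q := by
    intro q
    rw [← aeval_algHom_apply, hψx, AdjoinRoot.aeval_eq]
  have hle : ∀ r ∈ Mg k g, ψ r = 0 := by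
    have : Mg k g ≤ TwoSidedIdeal.ker ψ := by
      refine TwoSidedIdeal.span_le.2 ?_
      rintro _ (rfl | rfl)
      · simp [TwoSidedIdeal.mem_ker, hψx, hψy, ha]
      · simp [TwoSidedIdeal.mem_ker, hψ]
    intro r hr
    exact (TwoSidedIdeal.mem_ker _).1 (this hr)
  have hge : ∀ r, ψ r = 0 → r ∈ Mg k g := by
    intro r hr
    obtain ⟨n, q, h⟩ := clear_denom k (Mg k g) (e_mem_Mg k g) r
    refine mem_Mg_of k g n q r h ?_
    have := hle _ h
    rw [map_sub, map_mul, hr, mul_zero, zero_sub, neg_eq_zero, hψ] at this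
    exact AdjoinRoot.mk_eq_zero.1 this
  constructor
  · intro h
    have := hle 1 (h ▸ TwoSidedIdeal.mem_top _)
    simp at this
  · intro M hM
    obtain ⟨hMle, r, hrM, hr⟩ := SetLike.lt_iff_le_and_exists.1 hM
    have hr0 : ψ r ≠ 0 := fun h => hr (hge r h)
    obtain ⟨q, hq⟩ := AdjoinRoot.mk_surjective (g := g) (ψ r)⁻¹
    rw [← TwoSidedIdeal.one_mem_iff]
    have h1 : 1 - aeval (Xg k) q * r ∈ Mg k g := by
      apply hge
      rw [map_sub, map_mul, hψ, hq, inv_mul_cancel₀ hr0, map_one, sub_self]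
    have := M.add_mem (hMle h1) (M.mul_mem_left (aeval (Xg k) q) _ hrM)
    rwa [sub_add_cancel] at this

theorem exists_factor (k : Type) [Field k] (h : k[X]) (hh : ∀ n : ℕ, ¬ h ∣ X ^ n) :
    ∃ g : k[X], g.Monic ∧ Irreducible g ∧ (∀ n : ℕ, g ≠ X ^ n) ∧ g ∣ h := by
  have key : ∀ h' : k[X], ¬ X ∣ h' → ¬ IsUnit h' → 
      ∃ g : k[X], g.Monic ∧ Irreducible g ∧ (∀ n : ℕ, g ≠ X ^ n) ∧ g ∣ h' := by
    intro h' hX hu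
    obtain ⟨g, h1, h2, h3⟩ := exists_monic_irreducible_factor h' hu
    refine ⟨g, h1, h2, ?_, h3⟩
    rintro n rfl
    rcases n with _ | n
    · exact h2.not_isUnit (by simp)
    · exact hX ((Dvd.intro_left (X ^ n) (by rw [pow_succ])).trans h3)
  by_cases h0 : h = 0
  · subst h0
    obtain ⟨g, h1, h2, h3, -⟩ := key (X - C 1) (by simp [X_dvd_iff]) (not_isUnit_X_sub_C 1)
    exact ⟨g, h1, h2, h3, dvd_zero _⟩
  · obtain ⟨c, hc, hXc⟩ := exists_eq_pow_rootMultiplicity_mul_and_not_dvd h h0 0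
    rw [C_0, sub_zero] at hc hXc
    obtain ⟨g, h1, h2, h3, h4⟩ := key c hXc (by
      intro hu
      apply hh (h.rootMultiplicity 0)
      obtain ⟨u, rfl⟩ := hu
      conv_lhs => rw [hc]
      exact (Units.mul_right_dvd).2 dvd_rfl)
    exact ⟨g, h1, h2, h3, h4.trans (hc ▸ Dvd.intro_left _ rfl)⟩

open Polynomial in
/-- the maximal two-sided ideals of `R` are exactly the ideals
`⟨1 − xy, f(x)⟩` with `f` a monic irreducible polynomial in `k[X]` that is not a
monomial (`f ≠ X^n` for all `n ≥ 0`), where `f(x)` is the image of `f` under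
`k[X] → R`, `X ↦ x`. -/
theorem maximal_ideal_classification (k : Type) [Field k] (I : TwoSidedIdeal (R k)) :
    IsCoatom I ↔
      ∃ f : k[X], f.Monic ∧ Irreducible f ∧ (∀ n : ℕ, f ≠ X ^ n) ∧
        I = TwoSidedIdeal.span {1 - Xg k * Yg k, aeval (Xg k) f} := by
  constructor
  · intro hI
    have he := coatom_mem_e k I hI
    let J : Ideal k[X] :=
      { carrier := {q | aeval (Xg k) q ∈ I}
        zero_mem' := by simpa using I.zero_mem
        add_mem' := by
          intro a b ha hb
          simpa using I.add_mem ha hb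
        smul_mem' := by
          intro c a ha
          simpa using I.mul_mem_left _ _ ha }
    have hJ : ∀ q : k[X], q ∈ J ↔ aeval (Xg k) q ∈ I := fun q => Iff.rfl
    obtain ⟨h, hh⟩ := IsPrincipalIdealRing.principal J
    have hdvd : ∀ q : k[X], aeval (Xg k) q ∈ I ↔ h ∣ q := by
      intro q
      rw [← hJ, hh]
      exact Ideal.mem_span_singleton
    obtain ⟨g, h1, h2, h3, h4⟩ := exists_factor k h (by
      intro n hn
      apply hI.1
      rw [← TwoSidedIdeal.one_mem_iff]
      apply mem_of_pow k I n
      simpa using (hdvd _).2 hn)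
    refine ⟨g, h1, h2, h3, ?_⟩
    have hle : I ≤ Mg k g := by
      intro r hr
      obtain ⟨n, q, hq⟩ := clear_denom k (TwoSidedIdeal.span {1 - Xg k * Yg k})
        (TwoSidedIdeal.subset_span rfl) r
      have hqM : Xg k ^ n * r - aeval (Xg k) q ∈ Mg k g :=
        TwoSidedIdeal.span_le.2 (Set.singleton_subset_iff.2 (e_mem_Mg k g)) hq
      have hqI : Xg k ^ n * r - aeval (Xg k) q ∈ I :=
        TwoSidedIdeal.span_le.2 (Set.singleton_subset_iff.2 he) hq
      refine mem_Mg_of k g n q r hqM (h4.trans ((hdvd q).1 ?_))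
      have := I.sub_mem (I.mul_mem_left (Xg k ^ n) _ hr) hqI
      rwa [sub_sub_cancel] at this
    rcases hI.le_iff.1 hle with h | h
    · exact absurd h (Mg_coatom k g h1 h2 h3).1
    · exact h.symm
  · rintro ⟨f, h1, h2, h3, rfl⟩
    exact Mg_coatom k f h1 h2 h3
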